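/- Let G be a finite group acting on a finite-dimensional complex vector space V, with m₁, m₂ ∈ G and m₃ := (m₁m₂)⁻¹. Let V^{m} denote the fixed subspace of m and V^{𝐦} := V^{m₁} ∩ V^{m₂} ∩ V^{m₃}. Then the rational number dim V^{𝐦} − dim V + a(m₁) + a(m₂) + a(m₃) is a nonnegative integer, where a(m_i) denotes the age of m_i acting on V (restricted to V^{𝐦}, the ambient tangent directions). -/

import Mathlib

namespace ObsRank
set_option linter.unusedSectionVars false
open Module Module.End

/-- `e(t) = exp(2πit)`. -/
noncomputable def ee (t : ℝ) : ℂ := Complex.exp (2 * Real.pi * Complex.I * t)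

lemma ee_add (s t : ℝ) : ee (s + t) = ee s * ee t := by
  simp only [ee, ← Complex.exp_add]; push_cast; ring_nf

lemma ee_zero : ee 0 = 1 := by simp [ee]

lemma ee_ne_zero (t : ℝ) : ee t ≠ 0 := Complex.exp_ne_zero _

lemma ee_eq (t : ℝ) : ee t = Complex.exp ((2 * Real.pi * t : ℝ) * Complex.I) := by
  simp only [ee]; push_cast; ring_nf

lemma norm_ee (t : ℝ) : ‖ee t‖ = 1 := by
  rw [ee_eq, Complex.norm_exp_ofReal_mul_I]

lemma ee_eq_one_iff (t : ℝ) : ee t = 1 ↔ ∃ n : ℤ, t = n := by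
  have h2 : (2 * Real.pi * Complex.I : ℂ) ≠ 0 := Complex.two_pi_I_ne_zero
  rw [ee, Complex.exp_eq_one_iff]
  refine exists_congr fun n => ?_
  constructor
  · intro h
    have : (t : ℂ) = n := mul_left_cancel₀ h2 (by rw [h]; ring)
    exact_mod_cast this
  · intro h
    subst h; push_cast; ring

lemma ee_eq_ee_iff (s t : ℝ) : ee s = ee t ↔ ∃ n : ℤ, s - t = n := by
  rw [← ee_eq_one_iff]
  have : ee s = ee (s - t) * ee t := by rw [← ee_add]; simp
  rw [this]
  constructor
  · intro h
    exact mul_right_cancel₀ (ee_ne_zero t) (by rw [h, one_mul])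
  · intro h; rw [h, one_mul]

lemma ee_inj {s t : ℝ} (hs : 0 ≤ s) (hs1 : s < 1) (ht : 0 ≤ t) (ht1 : t < 1) :
    ee s = ee t ↔ s = t := by
  rw [ee_eq_ee_iff]
  constructor
  · rintro ⟨n, hn⟩
    have h1 : (n : ℝ) < 1 := by linarith
    have h2 : (-1 : ℝ) < n := by linarith
    have h1' : n < 1 := by exact_mod_cast h1
    have h2' : -1 < n := by exact_mod_cast h2
    have : n = 0 := by omega
    subst this
    push_cast at hn; linarith
  · rintro rfl; exact ⟨0, by simp⟩

lemma ee_sum {ι : Type*} (s : Finset ι) (f : ι → ℝ) : ee (∑ i ∈ s, f i) = ∏ i ∈ s, ee (f i) := by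
  classical
  induction s using Finset.induction_on with
  | empty => simp [ee_zero]
  | insert a s ha ih => rw [Finset.sum_insert ha, Finset.prod_insert ha, ee_add, ih]

lemma ee_nsmul (n : ℕ) (t : ℝ) : ee (n * t) = ee t ^ n := by
  induction n with
  | zero => simp [ee_zero]
  | succ n ih => rw [pow_succ, ← ih, ← ee_add]; push_cast; ring_nf

lemma exists_ee {z : ℂ} (hz : ‖z‖ = 1) : ∃ t : ℝ, 0 ≤ t ∧ t < 1 ∧ ee t = z := by
  refine ⟨Int.fract (Complex.arg z / (2 * Real.pi)), Int.fract_nonneg _, Int.fract_lt_one _, ?_⟩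
  have h1 : ee (Int.fract (Complex.arg z / (2 * Real.pi))) = ee (Complex.arg z / (2 * Real.pi)) := by
    rw [ee_eq_ee_iff]
    refine ⟨-⌊Complex.arg z / (2 * Real.pi)⌋, ?_⟩
    have := Int.self_sub_floor (Complex.arg z / (2 * Real.pi))
    push_cast; linarith
  rw [h1, ee_eq]
  have : 2 * Real.pi * (Complex.arg z / (2 * Real.pi)) = Complex.arg z := by
    field_simp
  rw [this]
  have := Complex.norm_mul_exp_arg_mul_I z
  rw [hz] at this
  simpa using this

variable {V : Type*} [NormedAddCommGroup V] [InnerProductSpace ℂ V] [FiniteDimensional ℂ V]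

/-- preserves the inner product -/
def Isom (T : V →ₗ[ℂ] V) : Prop := ∀ x y, inner ℂ (T x) (T y) = inner ℂ x y

lemma Isom.eig_norm {T : V →ₗ[ℂ] V} (hT : Isom T) {μ : ℂ} {x : V} (hx : x ≠ 0)
    (h : T x = μ • x) : ‖μ‖ = 1 := by
  have h1 := hT x x
  rw [h, inner_smul_left, inner_smul_right, ← mul_assoc] at h1
  have h2 : inner ℂ x x ≠ 0 := by simpa using hx
  have h3 : (starRingEnd ℂ) μ * μ = 1 := mul_right_cancel₀ h2 (by rw [h1, one_mul])
  have h4 : ‖μ‖ * ‖μ‖ = 1 := by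
    have := congrArg norm h3
    simpa using this
  nlinarith [norm_nonneg μ]

lemma Isom.orth {T : V →ₗ[ℂ] V} (hT : Isom T) {μ ν : ℂ} (hμν : μ ≠ ν) {x y : V}
    (hx : T x = μ • x) (hy : T y = ν • y) : inner ℂ x y = 0 := by
  by_cases hx0 : x = 0
  · simp [hx0]
  have hn := hT.eig_norm hx0 hx
  have h1 := hT x y
  rw [hx, hy, inner_smul_left, inner_smul_right, ← mul_assoc] at h1
  have h3 : (starRingEnd ℂ) μ * μ = 1 := by
    rw [Complex.conj_mul', hn]; simp
  by_contra h
  have h4 : (starRingEnd ℂ) μ * ν = 1 := mul_right_cancel₀ h (by rw [h1, one_mul])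
  have h5 : (starRingEnd ℂ) μ ≠ 0 := left_ne_zero_of_mul_eq_one h3
  exact hμν (mul_left_cancel₀ h5 (h3.trans h4.symm))

/-- orthonormal diagonalization with angles in `[0,1)` -/
def Diag {n : ℕ} (T : V →ₗ[ℂ] V) (b : OrthonormalBasis (Fin n) ℂ V) (θ : Fin n → ℝ) : Prop :=
  ∀ i, T (b i) = ee (θ i) • b i ∧ 0 ≤ θ i ∧ θ i < 1

lemma Isom.exists_diag {T : V →ₗ[ℂ] V} (hT : Isom T) {n : ℕ} (hn : finrank ℂ V = n) :
    ∃ (b : OrthonormalBasis (Fin n) ℂ V) (θ : Fin n → ℝ), Diag T b θ := by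
  classical
  subst hn
  have hof : OrthogonalFamily ℂ (fun μ : Eigenvalues T => eigenspace T (μ : ℂ))
      fun μ => (eigenspace T (μ : ℂ)).subtypeₗᵢ := by
    apply OrthogonalFamily.of_pairwise
    intro μ ν hμν x hx y hy
    refine hT.orth ?_ (mem_eigenspace_iff.mp hy) (mem_eigenspace_iff.mp hx)
    intro h
    exact hμν (Subtype.ext h.symm)
  have hbot : (⨆ μ : Eigenvalues T, eigenspace T (μ : ℂ))ᗮ = ⊥ := by
    by_contra hne
    set W := (⨆ μ : Eigenvalues T, eigenspace T (μ : ℂ))ᗮ with hW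
    have hmem : ∀ x, x ∈ W ↔ ∀ (μ : Eigenvalues T) (w : V), T w = (μ : ℂ) • w → inner ℂ w x = 0 := by
      intro x
      rw [hW, ← Submodule.iInf_orthogonal, Submodule.mem_iInf]
      refine forall_congr' fun μ => ?_
      rw [Submodule.mem_orthogonal]
      simp only [mem_eigenspace_iff]
    have hinv : ∀ x ∈ W, T x ∈ W := by
      intro x hx
      rw [hmem] at hx ⊢
      intro μ w hw
      by_cases hw0 : w = 0
      · simp [hw0]
      have hμ : (μ : ℂ) ≠ 0 := by
        have := hT.eig_norm hw0 hw
        intro h; simp [h] at this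
      have h1 := hT w x
      rw [hw, inner_smul_left, hx μ w hw] at h1
      exact (mul_eq_zero.mp h1).resolve_left (by simpa using hμ)
    have : Nontrivial W := Submodule.nontrivial_iff_ne_bot.mpr hne
    obtain ⟨μ, hμ⟩ := Module.End.exists_eigenvalue (T.restrict hinv)
    obtain ⟨x, hx⟩ := hμ.exists_hasEigenvector
    have hx1 : T (x : V) = μ • (x : V) := by
      have := congrArg Subtype.val hx.apply_eq_smul
      simpa using this
    have hx0 : (x : V) ≠ 0 := by simpa using hx.2
    have hev : HasEigenvalue T μ := hasEigenvalue_of_hasEigenvector ⟨mem_eigenspace_iff.mpr hx1, hx0⟩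
    have := (hmem x).mp x.2 ⟨μ, hev⟩ x hx1
    exact hx0 (by simpa using this)
  have hint := hof.isInternal_iff.mpr hbot
  refine ⟨hint.subordinateOrthonormalBasis rfl hof, ?_⟩
  have : ∀ i, ∃ t : ℝ, T (hint.subordinateOrthonormalBasis rfl hof i) =
      ee t • (hint.subordinateOrthonormalBasis rfl hof i) ∧ 0 ≤ t ∧ t < 1 := by
    intro i
    have h1 := mem_eigenspace_iff.mp (hint.subordinateOrthonormalBasis_subordinate rfl i hof)
    have hb0 : hint.subordinateOrthonormalBasis rfl hof i ≠ 0 :=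
      (hint.subordinateOrthonormalBasis rfl hof).orthonormal.ne_zero i
    obtain ⟨t, h0, h1', h2⟩ := exists_ee (hT.eig_norm hb0 h1)
    exact ⟨t, by rw [h2]; exact h1, h0, h1'⟩
  choose θ hθ using this
  exact ⟨θ, hθ⟩

section diag
variable {n : ℕ} {T : V →ₗ[ℂ] V} {b : OrthonormalBasis (Fin n) ℂ V} {θ : Fin n → ℝ}

lemma Diag.repr_apply (h : Diag T b θ) (x : V) (i : Fin n) :
    b.repr (T x) i = ee (θ i) * b.repr x i := by
  have : T x = ∑ j, b.repr x j • (ee (θ j) • b j) := by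
    conv_lhs => rw [← b.sum_repr x]
    rw [map_sum]
    refine Finset.sum_congr rfl fun j _ => ?_
    rw [map_smul, (h j).1]
  rw [this, b.repr_apply_apply, inner_sum]
  simp only [inner_smul_right, OrthonormalBasis.inner_eq_ite]
  simp [mul_comm]

lemma finrank_span_image (b : OrthonormalBasis (Fin n) ℂ V) (p : Fin n → Prop) [DecidablePred p] :
    finrank ℂ (Submodule.span ℂ (b '' {i | p i})) = (Finset.univ.filter p).card := by
  have h : LinearIndependent ℂ (fun i : {i // p i} => b i) :=
    b.orthonormal.linearIndependent.comp (fun i : {i // p i} => (i : Fin n)) Subtype.val_injective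
  have := finrank_span_eq_card h
  rw [Fintype.card_subtype] at this
  rw [← this]
  have h2 : b '' {i | p i} = Set.range (fun i : {i // p i} => b i) := by
    ext x; simp
  rw [h2]

lemma mem_span_image (b : OrthonormalBasis (Fin n) ℂ V) (p : Fin n → Prop) (x : V) :
    x ∈ Submodule.span ℂ (b '' {i | p i}) ↔ ∀ i, ¬ p i → b.repr x i = 0 := by
  have := b.toBasis.mem_span_image (m := x) (s := {i | p i})
  rw [OrthonormalBasis.coe_toBasis] at this
  rw [this]
  constructor
  · intro h i hi
    by_contra h0
    exact hi (h (by simpa using h0))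
  · intro h i hi
    by_contra h0
    have := h i h0
    simp [this] at hi

lemma Diag.mem_eig_iff (h : Diag T b θ) (μ : ℂ) (x : V) :
    x ∈ eigenspace T μ ↔ ∀ i, ¬ (ee (θ i) = μ) → b.repr x i = 0 := by
  rw [mem_eigenspace_iff]
  constructor
  · intro hx i hi
    have h1 := h.repr_apply x i
    rw [hx] at h1
    simp only [map_smul, PiLp.smul_apply, smul_eq_mul] at h1
    by_contra h0
    exact hi (mul_right_cancel₀ h0 h1.symm)
  · intro hx
    apply b.repr.injective
    ext i
    rw [h.repr_apply x i]
    by_cases hi : ee (θ i) = μ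
    · simp [hi]
    · simp [hx i hi]

lemma Diag.finrank_eig (h : Diag T b θ) (μ : ℂ) :
    finrank ℂ (eigenspace T μ) = (Finset.univ.filter (fun i => ee (θ i) = μ)).card := by
  classical
  rw [← finrank_span_image b]
  have h2 : eigenspace T μ = Submodule.span ℂ (b '' {i | ee (θ i) = μ}) := by
    ext x
    rw [h.mem_eig_iff, mem_span_image b (fun i => ee (θ i) = μ)]
  rw [h2]

lemma Diag.ee_eq_one (h : Diag T b θ) (i : Fin n) : ee (θ i) = 1 ↔ θ i = 0 := by
  rw [← ee_zero]
  exact ee_inj (h i).2.1 (h i).2.2 le_rfl one_pos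

lemma Diag.finrank_fix (h : Diag T b θ) :
    finrank ℂ (eigenspace T 1) = (Finset.univ.filter (fun i => θ i = 0)).card := by
  rw [h.finrank_eig]
  congr 1
  ext i
  simp [h.ee_eq_one]

lemma Diag.det (h : Diag T b θ) : LinearMap.det T = ee (∑ i, θ i) := by
  rw [ee_sum, ← LinearMap.det_toMatrix b.toBasis]
  have : LinearMap.toMatrix b.toBasis b.toBasis T = Matrix.diagonal (fun i => ee (θ i)) := by
    ext i j
    rw [LinearMap.toMatrix_apply]
    simp only [OrthonormalBasis.coe_toBasis, (h j).1, OrthonormalBasis.coe_toBasis_repr_apply]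
    rw [map_smul]
    by_cases hij : i = j
    · subst hij; simp
    · simp [hij, Matrix.diagonal_apply_ne]
  rw [this, Matrix.det_diagonal]

/-- quadratic form -/
lemma Diag.quad (h : Diag T b θ) (s : ℝ) (x : V) :
    (ee (-s / 2) * (inner ℂ x (T x) - inner ℂ x x)).re =
      ∑ i, ‖b.repr x i‖ ^ 2 * (-2 * Real.sin (Real.pi * θ i) * Real.sin (Real.pi * (θ i - s))) := by
  have h1 : ∀ y, inner ℂ x y = ∑ i, (starRingEnd ℂ) (b.repr x i) * b.repr y i := by
    intro y
    rw [← b.repr.inner_map_map, PiLp.inner_apply]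
    simp [mul_comm]
  rw [h1, h1, ← Finset.sum_sub_distrib, Finset.mul_sum, Complex.re_sum]
  refine Finset.sum_congr rfl fun i _ => ?_
  rw [h.repr_apply]
  have h2 : ee (-s / 2) * ((starRingEnd ℂ) (b.repr x i) * (ee (θ i) * b.repr x i) -
      (starRingEnd ℂ) (b.repr x i) * b.repr x i) =
      ((‖b.repr x i‖ ^ 2 : ℝ) : ℂ) * (ee (-s / 2 + θ i) - ee (-s / 2)) := by
    rw [ee_add]
    have := Complex.conj_mul' (b.repr x i)
    push_cast
    rw [← this]; ring
  rw [h2, Complex.re_ofReal_mul]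
  congr 1
  rw [ee_eq, ee_eq, Complex.sub_re, Complex.exp_ofReal_mul_I_re, Complex.exp_ofReal_mul_I_re,
    Real.cos_sub_cos]
  ring_nf

end diag

section count
variable {n : ℕ} {A C : V →ₗ[ℂ] V} {b c : OrthonormalBasis (Fin n) ℂ V} {θ φ : Fin n → ℝ}

lemma key_mem (hA : Diag A b θ) (hC : Diag C c φ) {s : ℝ} (hs : 0 ≤ s) (hs1 : s < 1) {x : V}
    (hAC : A x = C x) (hU : ∀ i, ¬ (θ i ≤ s) → b.repr x i = 0)
    (hX : ∀ i, ¬ (s < φ i ∨ φ i = 0) → c.repr x i = 0) : x ∈ eigenspace C 1 := by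
  have h1 := hA.quad s x
  rw [hAC, hC.quad s x] at h1
  have hpi := Real.pi_pos
  have hR : 0 ≤ ∑ i, ‖b.repr x i‖ ^ 2 *
      (-2 * Real.sin (Real.pi * θ i) * Real.sin (Real.pi * (θ i - s))) := by
    refine Finset.sum_nonneg fun i _ => ?_
    by_cases hi : θ i ≤ s
    · have a1 : 0 ≤ Real.sin (Real.pi * θ i) := by
        apply Real.sin_nonneg_of_nonneg_of_le_pi
        · exact mul_nonneg hpi.le (hA i).2.1
        · nlinarith [(hA i).2.2]
      have a2 : 0 ≤ Real.sin (Real.pi * (s - θ i)) := by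
        apply Real.sin_nonneg_of_nonneg_of_le_pi
        · exact mul_nonneg hpi.le (by linarith)
        · nlinarith [(hA i).2.1]
      have a3 : Real.sin (Real.pi * (θ i - s)) = - Real.sin (Real.pi * (s - θ i)) := by
        rw [← Real.sin_neg]; ring_nf
      rw [a3]
      have := mul_nonneg a1 a2
      exact mul_nonneg (sq_nonneg _) (by nlinarith)
    · simp [hU i hi]
  have hpos : ∀ i, s < φ i → 0 < Real.sin (Real.pi * φ i) * Real.sin (Real.pi * (φ i - s)) := by
    intro i hi
    apply mul_pos
    · apply Real.sin_pos_of_pos_of_lt_pi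
      · exact mul_pos hpi (by linarith)
      · nlinarith [(hC i).2.2]
    · apply Real.sin_pos_of_pos_of_lt_pi
      · exact mul_pos hpi (by linarith)
      · nlinarith [(hC i).2.2]
  have hL : ∀ i ∈ Finset.univ, ‖c.repr x i‖ ^ 2 *
      (-2 * Real.sin (Real.pi * φ i) * Real.sin (Real.pi * (φ i - s))) ≤ 0 := by
    intro i _
    by_cases hi : s < φ i
    · have := hpos i hi
      exact mul_nonpos_of_nonneg_of_nonpos (sq_nonneg _) (by nlinarith)
    · by_cases h0 : φ i = 0
      · simp [h0]
      · simp [hX i (by tauto)]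
  have hz : ∑ i, ‖c.repr x i‖ ^ 2 *
      (-2 * Real.sin (Real.pi * φ i) * Real.sin (Real.pi * (φ i - s))) = 0 :=
    le_antisymm (Finset.sum_nonpos hL) (h1 ▸ hR)
  rw [Finset.sum_eq_zero_iff_of_nonpos hL] at hz
  rw [hC.mem_eig_iff]
  intro i hi
  rw [hC.ee_eq_one] at hi
  by_cases hsi : s < φ i
  · have h2 := hz i (Finset.mem_univ i)
    have h3 := hpos i hsi
    rcases mul_eq_zero.mp h2 with h4 | h4
    · simpa using h4
    · exfalso; nlinarith
  · exact hX i (by tauto)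

lemma key_count (hA : Diag A b θ) (hC : Diag C c φ) (K : Submodule ℂ V)
    (hK : ∀ x ∈ K, A x = C x) {s : ℝ} (hs : 0 ≤ s) (hs1 : s < 1) :
    (Finset.univ.filter (fun i => s < φ i)).card + finrank ℂ (eigenspace C 1) + finrank ℂ K ≤
      (Finset.univ.filter (fun i => s < θ i)).card
        + finrank ℂ (eigenspace C 1 ⊓ K : Submodule ℂ V) + n := by
  classical
  have hn : finrank ℂ V = n := by simpa using finrank_eq_card_basis b.toBasis
  set U := Submodule.span ℂ (b '' {i | θ i ≤ s}) with hUdef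
  set X := Submodule.span ℂ (c '' {i | s < φ i ∨ φ i = 0}) with hXdef
  have hU : finrank ℂ U + (Finset.univ.filter (fun i => s < θ i)).card = n := by
    rw [hUdef, finrank_span_image b (fun i => θ i ≤ s)]
    have := Finset.card_filter_add_card_filter_not (s := (Finset.univ : Finset (Fin n)))
      (fun i => θ i ≤ s)
    simpa using this
  have hX : finrank ℂ X = (Finset.univ.filter (fun i => s < φ i)).card
      + finrank ℂ (eigenspace C 1) := by
    rw [hXdef, finrank_span_image c (fun i => s < φ i ∨ φ i = 0), Finset.filter_or,
      Finset.card_union_of_disjoint, hC.finrank_fix]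
    rw [Finset.disjoint_filter]
    intro i _ h1 h2
    linarith
  have h1 := Submodule.finrank_sup_add_finrank_inf_eq X K
  have h2 := Submodule.finrank_sup_add_finrank_inf_eq (X ⊓ K) U
  have h3 : finrank ℂ (X ⊔ K : Submodule ℂ V) ≤ n := hn ▸ Submodule.finrank_le _
  have h4 : finrank ℂ (X ⊓ K ⊔ U : Submodule ℂ V) ≤ n := hn ▸ Submodule.finrank_le _
  have h5 : finrank ℂ (X ⊓ K ⊓ U : Submodule ℂ V) ≤
      finrank ℂ (eigenspace C 1 ⊓ K : Submodule ℂ V) := by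
    apply Submodule.finrank_mono
    rintro x ⟨⟨hx1, hx2⟩, hx3⟩
    refine ⟨key_mem hA hC hs hs1 (hK x hx2) ?_ ?_, hx2⟩
    · exact (mem_span_image b (fun i => θ i ≤ s) x).mp hx3
    · exact (mem_span_image c (fun i => s < φ i ∨ φ i = 0) x).mp hx1
  omega

/-- layer cake -/
lemma sum_eq_integral (f : Fin n → ℝ) (hf : ∀ i, 0 ≤ f i ∧ f i < 1) :
    IntervalIntegrable (fun s => ((Finset.univ.filter (fun i => s < f i)).card : ℝ))
      MeasureTheory.volume 0 1 ∧
    ∫ s in (0 : ℝ)..1, ((Finset.univ.filter (fun i => s < f i)).card : ℝ) = ∑ i, f i := by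
  have h1 : (fun s => ((Finset.univ.filter (fun i => s < f i)).card : ℝ)) =
      fun s => ∑ i, (if s < f i then (1 : ℝ) else 0) := by
    ext s; simp
  have hind : ∀ a : ℝ, (fun s => if s < a then (1 : ℝ) else 0) =
      (Set.Iio a).indicator (fun _ => (1 : ℝ)) := by
    intro a; ext s; simp [Set.indicator_apply]
  have hint : ∀ a : ℝ, ∀ x y : ℝ, IntervalIntegrable (fun s => if s < a then (1 : ℝ) else 0)
      MeasureTheory.volume x y := by
    intro a x y
    apply AntitoneOn.intervalIntegrable
    intro u _ v _ huv
    dsimp only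
    split_ifs <;> first | linarith | norm_num
  rw [h1]
  constructor
  · have := IntervalIntegrable.sum (μ := MeasureTheory.volume) (a := (0:ℝ)) (b := 1)
      (Finset.univ : Finset (Fin n))
      (f := fun i s => if s < f i then (1 : ℝ) else 0) (fun i _ => hint (f i) 0 1)
    have h2 : (fun s => ∑ i, (if s < f i then (1 : ℝ) else 0)) =
        ∑ i, fun s => (if s < f i then (1 : ℝ) else 0) := by
      ext s; simp
    rw [h2]
    exact this
  · rw [intervalIntegral.integral_finsetSum (fun i _ => hint (f i) 0 1)]
    refine Finset.sum_congr rfl fun i _ => ?_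
    rw [← intervalIntegral.integral_add_adjacent_intervals (hint (f i) 0 (f i)) (hint (f i) (f i) 1)]
    have e1 : ∫ s in (0 : ℝ)..(f i), (if s < f i then (1 : ℝ) else 0) =
        ∫ s in (0 : ℝ)..(f i), (1 : ℝ) := by
      apply intervalIntegral.integral_congr_ae
      have : ∀ᵐ s : ℝ ∂MeasureTheory.volume, s ≠ f i := by
        simp [MeasureTheory.ae_iff]
      filter_upwards [this] with s hs hs2
      rw [Set.uIoc_of_le (hf i).1] at hs2
      rw [if_pos (lt_of_le_of_ne hs2.2 hs)]
    have e2 : ∫ s in (f i)..(1 : ℝ), (if s < f i then (1 : ℝ) else 0) =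
        ∫ s in (f i)..(1 : ℝ), (0 : ℝ) := by
      apply intervalIntegral.integral_congr
      intro s hs
      rw [Set.uIcc_of_le (hf i).2.le] at hs
      simp [hs.1]
    rw [e1, e2]
    simp

lemma key_sum (hA : Diag A b θ) (hC : Diag C c φ) (K : Submodule ℂ V)
    (hK : ∀ x ∈ K, A x = C x) :
    ∑ i, φ i + finrank ℂ (eigenspace C 1) + finrank ℂ K ≤
      ∑ i, θ i + finrank ℂ (eigenspace C 1 ⊓ K : Submodule ℂ V) + n := by
  obtain ⟨i1, s1⟩ := sum_eq_integral φ (fun i => (hC i).2)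
  obtain ⟨i2, s2⟩ := sum_eq_integral θ (fun i => (hA i).2)
  have hmono : ∫ s in (0 : ℝ)..1, (((Finset.univ.filter (fun i => s < φ i)).card : ℝ)
      + ((finrank ℂ (eigenspace C 1) : ℝ) + finrank ℂ K)) ≤
      ∫ s in (0 : ℝ)..1, (((Finset.univ.filter (fun i => s < θ i)).card : ℝ)
        + ((finrank ℂ (eigenspace C 1 ⊓ K : Submodule ℂ V) : ℝ) + n)) := by
    apply intervalIntegral.integral_mono_on_of_le_Ioo zero_le_one
    · exact i1.add intervalIntegrable_const
    · exact i2.add intervalIntegrable_const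
    · intro s hs
      have := key_count hA hC K hK hs.1.le hs.2
      have h2 : (((Finset.univ.filter (fun i => s < φ i)).card + finrank ℂ (eigenspace C 1)
        + finrank ℂ K : ℕ) : ℝ) ≤ ((Finset.univ.filter (fun i => s < θ i)).card
        + finrank ℂ (eigenspace C 1 ⊓ K : Submodule ℂ V) + n : ℕ) := by exact_mod_cast this
      push_cast at h2
      linarith
  rw [intervalIntegral.integral_add i1 intervalIntegrable_const,
    intervalIntegral.integral_add i2 intervalIntegrable_const, s1, s2] at hmono
  simp only [intervalIntegral.integral_const, sub_zero, one_smul] at hmono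
  linarith

end count

section main
variable {n : ℕ}

lemma Diag.isom {T : V →ₗ[ℂ] V} {b : OrthonormalBasis (Fin n) ℂ V} {θ : Fin n → ℝ}
    (h : Diag T b θ) : Isom T := by
  intro x y
  rw [← b.repr.inner_map_map, ← b.repr.inner_map_map x y, PiLp.inner_apply, PiLp.inner_apply]
  refine Finset.sum_congr rfl fun i _ => ?_
  rw [h.repr_apply, h.repr_apply]
  have h3 : (starRingEnd ℂ) (ee (θ i)) * ee (θ i) = 1 := by
    rw [Complex.conj_mul', norm_ee]; simp
  simp only [RCLike.inner_apply, map_mul]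
  linear_combination ((starRingEnd ℂ) (b.repr x i) * b.repr y i) * h3

lemma Isom.mul {A B : V →ₗ[ℂ] V} (hA : Isom A) (hB : Isom B) : Isom (A * B) := by
  intro x y
  rw [Module.End.mul_apply, Module.End.mul_apply, hA, hB]

lemma det_int {A B : V →ₗ[ℂ] V} {a b c : OrthonormalBasis (Fin n) ℂ V} {α β γ : Fin n → ℝ}
    (hA : Diag A a α) (hB : Diag B b β) (hC : Diag (A * B) c γ) :
    ∃ z : ℤ, ∑ i, α i + ∑ i, β i - ∑ i, γ i = z := by
  rw [← ee_eq_ee_iff, ← hC.det, ee_add, ← hA.det, ← hB.det, map_mul]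

lemma rank_one {A R : V →ₗ[ℂ] V} {a b c : OrthonormalBasis (Fin n) ℂ V} {α β γ : Fin n → ℝ}
    (hA : Diag A a α) (hR : Diag R b β) (hC : Diag (A * R) c γ) (j : Fin n)
    (hj : ∀ i, i ≠ j → β i = 0) :
    ∑ i, γ i + finrank ℂ (eigenspace (A * R) 1) ≤
      ∑ i, α i + ∑ i, β i + finrank ℂ (eigenspace A 1 ⊓ eigenspace R 1 : Submodule ℂ V) := by
  have hsum : ∑ i, β i = β j := Finset.sum_eq_single j (fun i _ h => hj i h) (by simp)
  have hK := key_sum hA hC (eigenspace R 1) (by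
    intro x hx
    rw [mem_eigenspace_iff, one_smul] at hx
    rw [Module.End.mul_apply, hx])
  have hinf : (eigenspace (A * R) 1 ⊓ eigenspace R 1 : Submodule ℂ V) =
      eigenspace A 1 ⊓ eigenspace R 1 := by
    ext x
    simp only [Submodule.mem_inf, mem_eigenspace_iff, one_smul, Module.End.mul_apply]
    constructor
    · rintro ⟨h1, h2⟩; rw [h2] at h1; exact ⟨h1, h2⟩
    · rintro ⟨h1, h2⟩; exact ⟨by rw [h2]; exact h1, h2⟩
  rw [hinf] at hK
  obtain ⟨z, hz⟩ := det_int hA hR hC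
  by_cases h0 : β j = 0
  · have : finrank ℂ (eigenspace R 1) = n := by
      rw [hR.finrank_fix, Finset.filter_true_of_mem]
      · simp
      · intro i _
        by_cases hi : i = j
        · rw [hi, h0]
        · exact hj i hi
    rw [this] at hK
    rw [hsum, h0]
    linarith
  · have h1 : n ≤ finrank ℂ (eigenspace R 1) + 1 := by
      rw [hR.finrank_fix]
      have h2 : (Finset.univ.erase j).card ≤ (Finset.univ.filter (fun i => β i = 0)).card := by
        apply Finset.card_le_card
        intro i hi
        simp only [Finset.mem_erase, Finset.mem_filter, Finset.mem_univ, true_and] at hi ⊢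
        exact hj i hi.1
      have h3 := Finset.card_erase_of_mem (Finset.mem_univ j)
      rw [Finset.card_univ, Fintype.card_fin] at h3
      omega
    have h1' : (n : ℝ) ≤ finrank ℂ (eigenspace R 1) + 1 := by exact_mod_cast h1
    have hpos : 0 < β j := lt_of_le_of_ne (hR j).2.1 (Ne.symm h0)
    have h4 : (-1 : ℝ) < (z : ℝ) + finrank ℂ (eigenspace A 1 ⊓ eigenspace R 1 : Submodule ℂ V)
        - finrank ℂ (eigenspace (A * R) 1) := by
      rw [← hz, hsum]; linarith
    have h5 : (-1 : ℤ) < z + finrank ℂ (eigenspace A 1 ⊓ eigenspace R 1 : Submodule ℂ V)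
        - finrank ℂ (eigenspace (A * R) 1) := by exact_mod_cast h4
    have h6 : (0 : ℤ) ≤ z + finrank ℂ (eigenspace A 1 ⊓ eigenspace R 1 : Submodule ℂ V)
        - finrank ℂ (eigenspace (A * R) 1) := by omega
    have h7 : (0 : ℝ) ≤ (z : ℝ) + finrank ℂ (eigenspace A 1 ⊓ eigenspace R 1 : Submodule ℂ V)
        - finrank ℂ (eigenspace (A * R) 1) := by exact_mod_cast h6
    rw [← hz] at h7
    linarith

/-- the operator with prescribed angles in a basis -/
noncomputable def dop (b : OrthonormalBasis (Fin n) ℂ V) (θ : Fin n → ℝ) : V →ₗ[ℂ] V :=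
  b.toBasis.constr ℂ (fun i => ee (θ i) • b i)

lemma dop_apply (b : OrthonormalBasis (Fin n) ℂ V) (θ : Fin n → ℝ) (i : Fin n) :
    dop b θ (b i) = ee (θ i) • b i := by
  have := b.toBasis.constr_basis ℂ (fun i => ee (θ i) • b i) i
  rwa [OrthonormalBasis.coe_toBasis] at this

lemma ext_basis (b : OrthonormalBasis (Fin n) ℂ V) {S T : V →ₗ[ℂ] V}
    (h : ∀ i, S (b i) = T (b i)) : S = T :=
  b.toBasis.ext (by simpa using h)

lemma main_ind (b : OrthonormalBasis (Fin n) ℂ V) (θ : Fin n → ℝ)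
    (hθ : ∀ i, 0 ≤ θ i ∧ θ i < 1) (S : Finset (Fin n)) :
    ∀ (A : V →ₗ[ℂ] V) (a c : OrthonormalBasis (Fin n) ℂ V) (α γ : Fin n → ℝ),
      Diag A a α → Diag (A * dop b (fun i => if i ∈ S then θ i else 0)) c γ →
      ∑ i, γ i + finrank ℂ (eigenspace (A * dop b (fun i => if i ∈ S then θ i else 0)) 1) ≤
      ∑ i, α i + ∑ i ∈ S, θ i + finrank ℂ
        (eigenspace A 1 ⊓ eigenspace (dop b (fun i => if i ∈ S then θ i else 0)) 1
          : Submodule ℂ V) := by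
  have hn : finrank ℂ V = n := by simpa using finrank_eq_card_basis b.toBasis
  induction S using Finset.induction_on with
  | empty =>
    intro A a c α γ hA hC
    have h1 : dop b (fun i => if i ∈ (∅ : Finset (Fin n)) then θ i else 0) = 1 := by
      apply ext_basis b
      intro i
      rw [dop_apply]; simp [ee_zero]
    rw [h1, mul_one] at hC ⊢
    have := key_sum hA hC ⊤ (fun _ _ => rfl)
    rw [finrank_top, hn, inf_top_eq] at this
    have h2 : eigenspace (1 : V →ₗ[ℂ] V) 1 = ⊤ := by
      ext x; simp [mem_eigenspace_iff]
    rw [h2, inf_top_eq, Finset.sum_empty]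
    linarith
  | insert j S hj ih =>
    intro A a c α γ hA hC
    set B := dop b (fun i => if i ∈ S then θ i else 0) with hB
    set R := dop b (fun i => if i = j then θ i else 0) with hRdef
    have hBR : dop b (fun i => if i ∈ insert j S then θ i else 0) = R * B := by
      apply ext_basis b
      intro i
      rw [Module.End.mul_apply, dop_apply, hB, dop_apply, map_smul, hRdef, dop_apply, smul_smul,
        ← ee_add]
      by_cases hi : i = j
      · subst hi; simp [hj]
      · simp [hi]
    rw [hBR, ← mul_assoc] at hC
    rw [hBR, ← mul_assoc, Finset.sum_insert hj]
    have hR : Diag R b (fun i => if i = j then θ i else 0) := by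
      intro i
      refine ⟨dop_apply _ _ _, ?_⟩
      dsimp only
      split_ifs
      · exact hθ i
      · norm_num
    obtain ⟨d, δ, hd⟩ := (hA.isom.mul hR.isom).exists_diag hn
    have s1 := rank_one hA hR hd j (fun i hi => by simp [hi])
    have s2 := ih (A * R) d c δ γ hd hC
    have hsum : ∑ i, (if i = j then θ i else 0) = θ j := by simp
    rw [hsum] at s1
    have d1 := Submodule.finrank_sup_add_finrank_inf_eq
      (eigenspace A 1 ⊓ eigenspace R 1 : Submodule ℂ V)
      (eigenspace (A * R) 1 ⊓ eigenspace B 1 : Submodule ℂ V)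
    have d2 : finrank ℂ (eigenspace A 1 ⊓ eigenspace R 1 ⊔ (eigenspace (A * R) 1 ⊓ eigenspace B 1)
        : Submodule ℂ V) ≤ finrank ℂ (eigenspace (A * R) 1) := by
      apply Submodule.finrank_mono
      apply sup_le _ inf_le_left
      rintro x ⟨h1, h2⟩
      have h1 := mem_eigenspace_iff.mp h1
      have h2 := mem_eigenspace_iff.mp h2
      rw [one_smul] at h1 h2
      rw [mem_eigenspace_iff, Module.End.mul_apply, h2, h1, one_smul]
    have d3 : finrank ℂ (eigenspace A 1 ⊓ eigenspace R 1 ⊓ (eigenspace (A * R) 1 ⊓ eigenspace B 1)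
        : Submodule ℂ V) ≤ finrank ℂ (eigenspace A 1 ⊓ eigenspace (R * B) 1 : Submodule ℂ V) := by
      apply Submodule.finrank_mono
      rintro x ⟨⟨h1, h2⟩, h3, h4⟩
      refine ⟨h1, ?_⟩
      have h2 := mem_eigenspace_iff.mp h2
      have h4 := mem_eigenspace_iff.mp h4
      rw [one_smul] at h2 h4
      apply mem_eigenspace_iff.mpr
      rw [Module.End.mul_apply, h4, h2, one_smul]
    have d4 : finrank ℂ (eigenspace A 1 ⊓ eigenspace R 1 : Submodule ℂ V)
        + finrank ℂ (eigenspace (A * R) 1 ⊓ eigenspace B 1 : Submodule ℂ V) ≤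
        finrank ℂ (eigenspace (A * R) 1)
        + finrank ℂ (eigenspace A 1 ⊓ eigenspace (R * B) 1 : Submodule ℂ V) := by omega
    have d5 : (finrank ℂ (eigenspace A 1 ⊓ eigenspace R 1 : Submodule ℂ V) : ℝ)
        + finrank ℂ (eigenspace (A * R) 1 ⊓ eigenspace B 1 : Submodule ℂ V) ≤
        finrank ℂ (eigenspace (A * R) 1)
        + finrank ℂ (eigenspace A 1 ⊓ eigenspace (R * B) 1 : Submodule ℂ V) := by
      exact_mod_cast d4
    linarith

lemma main_ineq {A B : V →ₗ[ℂ] V} {a b c : OrthonormalBasis (Fin n) ℂ V} {α β γ : Fin n → ℝ}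
    (hA : Diag A a α) (hB : Diag B b β) (hC : Diag (A * B) c γ) :
    ∑ i, γ i + finrank ℂ (eigenspace (A * B) 1) ≤
      ∑ i, α i + ∑ i, β i + finrank ℂ (eigenspace A 1 ⊓ eigenspace B 1 : Submodule ℂ V) := by
  have h : dop b (fun i => if i ∈ Finset.univ then β i else 0) = B := by
    apply ext_basis b
    intro i
    rw [dop_apply, (hB i).1]; simp
  have := main_ind b β (fun i => (hB i).2) Finset.univ A a c α γ hA (by rw [h]; exact hC)
  rwa [h] at this

/-- diagonalization of the inverse -/
lemma Diag.inv {T T' : V →ₗ[ℂ] V} {b : OrthonormalBasis (Fin n) ℂ V} {θ : Fin n → ℝ}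
    (h : Diag T b θ) (hT : T' * T = 1) : Diag T' b (fun i => if θ i = 0 then 0 else 1 - θ i) := by
  intro i
  obtain ⟨h1, h2, h3⟩ := h i
  constructor
  · have h4 : T' (T (b i)) = b i := by
      rw [← Module.End.mul_apply, hT, Module.End.one_apply]
    rw [h1, map_smul] at h4
    have h5 : ee (if θ i = 0 then 0 else 1 - θ i) * ee (θ i) = 1 := by
      rw [← ee_add, ee_eq_one_iff]
      split_ifs with h0
      · exact ⟨0, by simp [h0]⟩
      · exact ⟨1, by simp⟩
    dsimp only
    conv_rhs => rw [← h4, smul_smul, h5, one_smul]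
  · dsimp only
    split_ifs with h0
    · norm_num
    · have : 0 < θ i := lt_of_le_of_ne h2 (Ne.symm h0)
      constructor <;> linarith

lemma sum_inv (θ : Fin n → ℝ) : ∑ i, (if θ i = 0 then 0 else 1 - θ i) =
    n - (Finset.univ.filter (fun i => θ i = 0)).card - ∑ i, θ i := by
  have : ∀ i, (if θ i = 0 then 0 else 1 - θ i) = 1 - (if θ i = 0 then (1 : ℝ) else 0) - θ i := by
    intro i; split_ifs with h <;> simp [h]
  rw [Finset.sum_congr rfl (fun i _ => this i), Finset.sum_sub_distrib, Finset.sum_sub_distrib]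
  simp

lemma age_eq {T : V →ₗ[ℂ] V} {b : OrthonormalBasis (Fin n) ℂ V} {θ : Fin n → ℝ}
    (h : Diag T b θ) (r : ℕ) (hr : 0 < r) (hT : T ^ r = 1) :
    ((∑ k : Fin r, (k : ℚ) / r * finrank ℂ (eigenspace T
      (Complex.exp (2 * Real.pi * Complex.I * k / r))) : ℚ) : ℝ) = ∑ i, θ i := by
  have hr' : (0 : ℝ) < r := by exact_mod_cast hr
  have hk : ∀ k : Fin r, Complex.exp (2 * Real.pi * Complex.I * k / r) = ee ((k : ℝ) / r) := by
    intro k; rw [ee]; push_cast; ring_nf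
  have hk1 : ∀ k : Fin r, (0 : ℝ) ≤ (k : ℝ) / r ∧ ((k : ℕ) : ℝ) / r < 1 := by
    intro k
    refine ⟨by positivity, ?_⟩
    rw [div_lt_one hr']
    exact_mod_cast k.2
  have hc : ∀ k : Fin r, ((finrank ℂ (eigenspace T
      (Complex.exp (2 * Real.pi * Complex.I * k / r))) : ℕ) : ℝ) =
      ∑ i, if θ i = (k : ℝ) / r then (1 : ℝ) else 0 := by
    intro k
    rw [hk, h.finrank_eig, Finset.sum_boole]
    congr 2
    ext i
    simp [ee_inj (h i).2.1 (h i).2.2 (hk1 k).1 (hk1 k).2]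
  push_cast
  simp only [hc, Finset.mul_sum]
  rw [Finset.sum_comm]
  refine Finset.sum_congr rfl fun i _ => ?_
  have hp : ∀ m : ℕ, (T ^ m) (b i) = ee (θ i) ^ m • b i := by
    intro m
    induction m with
    | zero => simp
    | succ m ih =>
      rw [pow_succ', Module.End.mul_apply, ih, map_smul, (h i).1, smul_smul, pow_succ]
  have h1 : ee (r * θ i) = 1 := by
    rw [ee_nsmul]
    have := hp r
    rw [hT, Module.End.one_apply] at this
    have hb : b i ≠ 0 := b.orthonormal.ne_zero i
    have h2 : (ee (θ i) ^ r - 1) • b i = 0 := by rw [sub_smul, ← this, one_smul, sub_self]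
    rcases smul_eq_zero.mp h2 with h3 | h3
    · exact sub_eq_zero.mp h3
    · exact absurd h3 hb
  obtain ⟨z, hz⟩ := (ee_eq_one_iff _).mp h1
  have hz0 : (0 : ℝ) ≤ z := by rw [← hz]; exact mul_nonneg hr'.le (h i).2.1
  have hz1 : (z : ℝ) < r := by rw [← hz]; nlinarith [(h i).2.2]
  have hz0' : 0 ≤ z := by exact_mod_cast hz0
  lift z to ℕ using hz0'
  have hz1' : z < r := by exact_mod_cast hz1
  have hθ : θ i = (z : ℝ) / r := by
    rw [eq_div_iff hr'.ne']
    push_cast at hz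
    linarith
  rw [Finset.sum_eq_single (⟨z, hz1'⟩ : Fin r)]
  · simp [hθ]
  · intro k _ hkz
    rw [if_neg, mul_zero]
    intro h3
    rw [hθ, div_left_inj' hr'.ne'] at h3
    apply hkz
    ext
    have : z = (k : ℕ) := by exact_mod_cast h3
    exact this.symm
  · simp

end main

theorem final_isom (G : Type*) [Group G] [Fintype G]
    (ρ : G →* (V ≃ₗ[ℂ] V)) (hρ : ∀ g, Isom ((ρ g : V ≃ₗ[ℂ] V) : V →ₗ[ℂ] V)) (m₁ m₂ : G) :
    ∃ N : ℕ,
      (Module.finrank ℂ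
          ((Module.End.eigenspace ((ρ m₁ : V ≃ₗ[ℂ] V) : V →ₗ[ℂ] V) 1
            ⊓ Module.End.eigenspace ((ρ m₂ : V ≃ₗ[ℂ] V) : V →ₗ[ℂ] V) 1
            ⊓ Module.End.eigenspace ((ρ (m₁ * m₂)⁻¹ : V ≃ₗ[ℂ] V) : V →ₗ[ℂ] V) 1
            : Submodule ℂ V)) : ℚ)
        - Module.finrank ℂ V
        + (∑ k : Fin (orderOf m₁), (k : ℚ) / (orderOf m₁) *
            Module.finrank ℂ (Module.End.eigenspace
              ((ρ m₁ : V ≃ₗ[ℂ] V) : V →ₗ[ℂ] V)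
              (Complex.exp (2 * Real.pi * Complex.I * k / (orderOf m₁)))))
        + (∑ k : Fin (orderOf m₂), (k : ℚ) / (orderOf m₂) *
            Module.finrank ℂ (Module.End.eigenspace
              ((ρ m₂ : V ≃ₗ[ℂ] V) : V →ₗ[ℂ] V)
              (Complex.exp (2 * Real.pi * Complex.I * k / (orderOf m₂)))))
        + (∑ k : Fin (orderOf (m₁ * m₂)⁻¹), (k : ℚ) / (orderOf (m₁ * m₂)⁻¹) *
            Module.finrank ℂ (Module.End.eigenspace
              ((ρ (m₁ * m₂)⁻¹ : V ≃ₗ[ℂ] V) : V →ₗ[ℂ] V)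
              (Complex.exp (2 * Real.pi * Complex.I * k / (orderOf (m₁ * m₂)⁻¹)))))
      = N := by
  set A : V →ₗ[ℂ] V := ((ρ m₁ : V ≃ₗ[ℂ] V) : V →ₗ[ℂ] V) with hAdef
  set B : V →ₗ[ℂ] V := ((ρ m₂ : V ≃ₗ[ℂ] V) : V →ₗ[ℂ] V) with hBdef
  set D : V →ₗ[ℂ] V := ((ρ (m₁ * m₂)⁻¹ : V ≃ₗ[ℂ] V) : V →ₗ[ℂ] V) with hDdef
  have hpow : ∀ (g : G) (k : ℕ), ((ρ g : V ≃ₗ[ℂ] V) : V →ₗ[ℂ] V) ^ k =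
      ((ρ (g ^ k) : V ≃ₗ[ℂ] V) : V →ₗ[ℂ] V) := by
    intro g k
    induction k with
    | zero => ext x; simp
    | succ k ih => rw [pow_succ, ih]; ext x; simp [pow_succ]
  have hord : ∀ g : G, ((ρ g : V ≃ₗ[ℂ] V) : V →ₗ[ℂ] V) ^ orderOf g = 1 := by
    intro g; rw [hpow, pow_orderOf_eq_one]; ext x; simp
  have hAB : A * B = ((ρ (m₁ * m₂) : V ≃ₗ[ℂ] V) : V →ₗ[ℂ] V) := by
    ext x; simp [hAdef, hBdef]
  have hDAB : D * (A * B) = 1 := by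
    rw [hAB]; ext x
    rw [hDdef, Module.End.mul_apply, Module.End.one_apply, LinearEquiv.coe_coe, LinearEquiv.coe_coe,
      ← LinearEquiv.mul_apply, ← map_mul]
    simp
  obtain ⟨a, α, hA⟩ := (hρ m₁).exists_diag (n := finrank ℂ V) rfl
  obtain ⟨b, β, hB⟩ := (hρ m₂).exists_diag (n := finrank ℂ V) rfl
  rw [← hAdef] at hA
  rw [← hBdef] at hB
  obtain ⟨c, γ, hC⟩ := (hA.isom.mul hB.isom).exists_diag (n := finrank ℂ V) rfl
  have hD := hC.inv hDAB
  have a1 := age_eq hA (orderOf m₁) (orderOf_pos m₁) (hord m₁)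
  have a2 := age_eq hB (orderOf m₂) (orderOf_pos m₂) (hord m₂)
  have a3 := age_eq hD (orderOf (m₁ * m₂)⁻¹) (orderOf_pos _) (hord _)
  rw [sum_inv, ← hC.finrank_fix] at a3
  have hfix : (eigenspace A 1 ⊓ eigenspace B 1 ⊓ eigenspace D 1 : Submodule ℂ V) =
      eigenspace A 1 ⊓ eigenspace B 1 := by
    apply inf_eq_left.mpr
    rintro x ⟨h1, h2⟩
    have h1 := mem_eigenspace_iff.mp h1
    have h2 := mem_eigenspace_iff.mp h2
    rw [one_smul] at h1 h2
    rw [mem_eigenspace_iff, one_smul]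
    have h3 := LinearMap.congr_fun hDAB x
    rw [Module.End.mul_apply, Module.End.mul_apply, h2, h1] at h3
    exact h3
  rw [hfix]
  have hmain := main_ineq hA hB hC
  obtain ⟨z, hz⟩ := det_int hA hB hC
  have hnn : (0 : ℝ) ≤ (z : ℝ) + finrank ℂ (eigenspace A 1 ⊓ eigenspace B 1 : Submodule ℂ V)
      - finrank ℂ (eigenspace (A * B) 1) := by
    rw [← hz]; linarith
  have hnn' : (0 : ℤ) ≤ z + finrank ℂ (eigenspace A 1 ⊓ eigenspace B 1 : Submodule ℂ V)
      - finrank ℂ (eigenspace (A * B) 1) := by exact_mod_cast hnn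
  obtain ⟨N, hN⟩ := Int.eq_ofNat_of_zero_le hnn'
  refine ⟨N, ?_⟩
  have hN' : (z : ℝ) + finrank ℂ (eigenspace A 1 ⊓ eigenspace B 1 : Submodule ℂ V)
      - finrank ℂ (eigenspace (A * B) 1) = N := by exact_mod_cast hN
  rw [← @Rat.cast_inj ℝ]
  rw [Rat.cast_add, Rat.cast_add, Rat.cast_add, Rat.cast_sub, a1, a2, a3]
  push_cast
  linarith

end ObsRank


/-- Let a finite group `G` act linearly on a finite-dimensional complex
vector space `V` via `ρ`, let `m₁, m₂ ∈ G` and `m₃ := (m₁m₂)⁻¹`, and let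
`V^𝐦 = V^{m₁} ∩ V^{m₂} ∩ V^{m₃}` be the simultaneous fixed subspace (each `V^m` being
the eigenspace of `ρ(m)` with eigenvalue `1`).  With the age
`a(m) = Σ_{k=0}^{r−1} (k/r)·dim V_k` (for `r = orderOf m` and `V_k` the eigenspace of
`ρ(m)` with eigenvalue `exp(2πik/r)`), the rational number
`dim V^𝐦 − dim V + a(m₁) + a(m₂) + a(m₃)` is a nonnegative integer
(the rank of the Fantechi–Göttsche obstruction bundle `ℛ(𝐦)`). -/
theorem obstruction_rank_nonneg_integer
    (G : Type*) [Group G] [Fintype G]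
    (V : Type*) [AddCommGroup V] [Module ℂ V] [FiniteDimensional ℂ V]
    (ρ : G →* (V ≃ₗ[ℂ] V)) (m₁ m₂ : G) :
    ∃ N : ℕ,
      (Module.finrank ℂ
          ((Module.End.eigenspace ((ρ m₁ : V ≃ₗ[ℂ] V) : V →ₗ[ℂ] V) 1
            ⊓ Module.End.eigenspace ((ρ m₂ : V ≃ₗ[ℂ] V) : V →ₗ[ℂ] V) 1
            ⊓ Module.End.eigenspace ((ρ (m₁ * m₂)⁻¹ : V ≃ₗ[ℂ] V) : V →ₗ[ℂ] V) 1
            : Submodule ℂ V)) : ℚ)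
        - Module.finrank ℂ V
        + (∑ k : Fin (orderOf m₁), (k : ℚ) / (orderOf m₁) *
            Module.finrank ℂ (Module.End.eigenspace
              ((ρ m₁ : V ≃ₗ[ℂ] V) : V →ₗ[ℂ] V)
              (Complex.exp (2 * Real.pi * Complex.I * k / (orderOf m₁)))))
        + (∑ k : Fin (orderOf m₂), (k : ℚ) / (orderOf m₂) *
            Module.finrank ℂ (Module.End.eigenspace
              ((ρ m₂ : V ≃ₗ[ℂ] V) : V →ₗ[ℂ] V)
              (Complex.exp (2 * Real.pi * Complex.I * k / (orderOf m₂)))))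
        + (∑ k : Fin (orderOf (m₁ * m₂)⁻¹), (k : ℚ) / (orderOf (m₁ * m₂)⁻¹) *
            Module.finrank ℂ (Module.End.eigenspace
              ((ρ (m₁ * m₂)⁻¹ : V ≃ₗ[ℂ] V) : V →ₗ[ℂ] V)
              (Complex.exp (2 * Real.pi * Complex.I * k / (orderOf (m₁ * m₂)⁻¹)))))
      = N := by
  classical
  let e : V ≃ₗ[ℂ] EuclideanSpace ℂ (Fin (Module.finrank ℂ V)) :=
    (Module.finBasis ℂ V).equivFun.trans (WithLp.linearEquiv 2 ℂ _).symm
  let core : InnerProductSpace.Core ℂ V :=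
    { inner := fun x y => ∑ g : G, inner ℂ (e (ρ g x)) (e (ρ g y))
      conj_inner_symm := by
        intro x y
        rw [map_sum]
        exact Finset.sum_congr rfl fun g _ => inner_conj_symm _ _
      re_inner_nonneg := by
        intro x
        rw [map_sum]
        exact Finset.sum_nonneg fun g _ => inner_self_nonneg
      add_left := by
        intro x y z
        rw [← Finset.sum_add_distrib]
        refine Finset.sum_congr rfl fun g _ => ?_
        rw [map_add, map_add, inner_add_left]
      smul_left := by
        intro x y r
        rw [Finset.mul_sum]
        refine Finset.sum_congr rfl fun g _ => ?_
        rw [map_smul, map_smul, inner_smul_left]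
      definite := by
        intro x hx
        have h1 := congrArg Complex.re hx
        rw [Complex.re_sum, Complex.zero_re] at h1
        have h2 := (Finset.sum_eq_zero_iff_of_nonneg
          (fun g _ => inner_self_nonneg (𝕜 := ℂ) (x := e (ρ g x)))).mp h1 1 (Finset.mem_univ _)
        rw [inner_self_eq_norm_sq (𝕜 := ℂ)] at h2
        have h3 : e (ρ 1 x) = 0 := norm_eq_zero.mp (pow_eq_zero_iff two_ne_zero |>.mp h2)
        rw [map_one] at h3
        exact e.map_eq_zero_iff.mp h3 }
  letI : NormedAddCommGroup V := core.toNormedAddCommGroup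
  letI : InnerProductSpace ℂ V := InnerProductSpace.ofCore core.toCore
  refine ObsRank.final_isom G ρ ?_ m₁ m₂
  intro g x y
  change ∑ h : G, inner ℂ (e (ρ h (ρ g x))) (e (ρ h (ρ g y))) =
    ∑ h : G, inner ℂ (e (ρ h x)) (e (ρ h y))
  rw [← Equiv.sum_comp (Equiv.mulRight g) (fun h => inner ℂ (e (ρ h x)) (e (ρ h y)))]
  refine Finset.sum_congr rfl fun h _ => ?_
  simp
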